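/- Let R : ℝ → ℝ be admissible with in addition R′(0) = 1/2. Then for every real v with δ ≤ v < 1/2 there is exactly one t > 0 with R′(t) = v. (This is the key step in Lemma 1.2.3: for points y₀, y₁ ∈ S^n with dist(y₀,y₁) ≥ 2πδ, the image τ(F₀) of a cotangent fibre under a δ-wobbly model Dehn twist meets the fibre F₁ transversally in exactly one point y, determined by 2πR′(‖y‖) = dist(y₀,y₁).) -/

import Mathlib

/-! The key step of Lemma 1.2.3 of Seidel, "A long exact sequence for symplectic Floer
cohomology": for the angle function of a δ-wobbly model Dehn twist with R′(0) = 1/2,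
every value v ∈ [δ, 1/2) is attained by R′ at exactly one positive point. -/

/-- The conditions on the angle function of a δ-wobbly model Dehn twist. -/
def Admissible (lam δ : ℝ) (R : ℝ → ℝ) : Prop :=
  ContDiff ℝ 2 R ∧
  (∀ t : ℝ, 0 ≤ t → 0 ≤ deriv R t) ∧
  (∀ t : ℝ, lam ≤ t → R t = 0) ∧
  (∀ t : ℝ, 0 ≤ t → δ ≤ deriv R t → deriv (deriv R) t < 0)

/-- If `g` has negative derivative wherever it takes the value `g a` to the right of `a`,
then it stays strictly below `g a` there. -/
theorem lt_of_deriv_neg_of_eq {g : ℝ → ℝ} (hg : Differentiable ℝ g) {a b : ℝ} (hab : a < b)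
    (h : ∀ x ∈ Set.Icc a b, g x = g a → deriv g x < 0) : g b < g a := by
  have hle : ∀ ⦃x⦄, x ∈ Set.Icc a b → g x ≤ g a :=
    image_le_of_deriv_right_lt_deriv_boundary hg.continuous.continuousOn
      (fun x _ => (hg x).hasDerivAt.hasDerivWithinAt) le_rfl
      (fun x => hasDerivAt_const x (g a))
      (fun x hx hxa => h x (Set.Ico_subset_Icc_self hx) hxa)
  refine lt_of_le_of_ne (hle (Set.right_mem_Icc.2 hab.le)) fun hba => ?_
  have hslope := (hasDerivAt_iff_tendsto_slope.1 (hg b).hasDerivAt).eventually_lt_const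
    (h b (Set.right_mem_Icc.2 hab.le) hba)
  obtain ⟨x, hx, hax, hxb⟩ :=
    ((hslope.filter_mono (nhdsLT_le_nhdsNE b)).and (Ioo_mem_nhdsLT hab)).exists
  rw [slope_def_field, div_neg_iff] at hx
  have := hle ⟨hax.le, hxb.le⟩
  rcases hx with ⟨_, _⟩ | ⟨_, _⟩ <;> linarith

theorem unique_angle_value (lam δ : ℝ) (hlam : 0 < lam) (hδ0 : 0 < δ) (hδ : δ < 1/2)
    (R : ℝ → ℝ) (hR : Admissible lam δ R) (hR0 : deriv R 0 = 1/2) :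
    ∀ v : ℝ, δ ≤ v → v < 1/2 → ∃! t : ℝ, 0 < t ∧ deriv R t = v := by
  obtain ⟨hsmooth, -, hzero, hneg⟩ := hR
  have hdiff : Differentiable ℝ (deriv R) :=
    (ContDiff.deriv' (n := 1) hsmooth).differentiable one_ne_zero
  intro v hδv hv
  have hlt : ∀ a b : ℝ, 0 < a → a < b → deriv R a = v → deriv R b < v := by
    rintro a b ha hab rfl
    exact lt_of_deriv_neg_of_eq hdiff hab fun x hx hxa =>
      hneg x (ha.le.trans hx.1) (hxa ▸ hδv)
  have hend : deriv R (lam + 1) = 0 := by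
    have : R =ᶠ[nhds (lam + 1)] fun _ => 0 := by
      filter_upwards [Ioi_mem_nhds (lt_add_one lam)] with t ht using hzero t (le_of_lt ht)
    rw [this.deriv_eq, deriv_const]
  obtain ⟨t, ht, htv⟩ := intermediate_value_Ioo' (by linarith : (0 : ℝ) ≤ lam + 1)
    hdiff.continuous.continuousOn
    (show v ∈ Set.Ioo (deriv R (lam + 1)) (deriv R 0) by
      rw [hend, hR0]
      exact ⟨hδ0.trans_le hδv, hv⟩)
  refine ⟨t, ⟨ht.1, htv⟩, fun s ⟨hs, hsv⟩ => ?_⟩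
  rcases lt_trichotomy s t with hst | hst | hst
  · exact absurd htv (hlt s t hs hst hsv).ne
  · exact hst
  · exact absurd hsv (hlt t s ht.1 hst htv).ne
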